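/- For an odd prime p and n ≥ 3, the cyclicity degree of the modular p-group M_{p^n} equals ((n−1)p + 2) / ((n−1)p + n + 1). -/

import Mathlib

/-- The cyclicity degree of a finite group: the ratio of the number of cyclic
subgroups to the number of all subgroups. -/
noncomputable def cdeg (G : Type*) [Group G] : ℚ :=
  (Nat.card {H : Subgroup G // IsCyclic H} : ℚ) / (Nat.card (Subgroup G) : ℚ)

open Finset in
/-- Each cyclic subgroup of order `d` contains exactly `φ d` elements of order `d`. -/
theorem card_cyclic_subgroups_mul_totient {G : Type*} [Group G] [Finite G] (d : ℕ) :
    Nat.card {H : Subgroup G // IsCyclic H ∧ Nat.card H = d} * d.totient =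
      Nat.card {g : G // orderOf g = d} := by
  classical
  have := Fintype.ofFinite G
  have := Fintype.ofFinite (Subgroup G)
  rw [Nat.card_eq_fintype_card, Nat.card_eq_fintype_card, Fintype.card_subtype,
    Fintype.card_subtype]
  rw [card_eq_sum_card_fiberwise (f := fun g : G => Subgroup.zpowers g)
    (t := univ.filter fun H : Subgroup G => IsCyclic H ∧ Nat.card H = d)]
  · rw [sum_const_nat (m := d.totient)]
    intro H hH
    obtain ⟨hc, hd⟩ := (mem_filter.mp hH).2
    have hcard := IsCyclic.card_orderOf_eq_totient (α := H) (d := d) (by rw [← Nat.card_eq_fintype_card, hd])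
    rw [← hcard, ← card_map (Function.Embedding.subtype _)]
    congr 1
    ext g
    simp only [mem_filter, mem_univ, true_and, mem_map, Function.Embedding.coe_subtype,
      Subtype.exists, exists_and_right, exists_eq_right, Subgroup.orderOf_mk]
    constructor
    · rintro ⟨hg, rfl⟩
      exact ⟨Subgroup.mem_zpowers g, hg⟩
    · rintro ⟨hgH, hg⟩
      refine ⟨hg, Subgroup.eq_of_le_of_card_ge (Subgroup.zpowers_le.mpr hgH) ?_⟩
      rw [Nat.card_zpowers, hg, hd]
  · intro g hg
    have hg' : orderOf g = d := by simpa using hg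
    simp only [coe_filter, mem_univ, true_and, Set.mem_ofPred_eq]
    exact ⟨inferInstance, by rw [Nat.card_zpowers, hg']⟩

/-- A product formula for powers when the commutator is central. -/
theorem mul_pow_of_commutator_central {G : Type*} [Group G] {g h c : G}
    (hc : ∀ a : G, Commute c a) (hgh : h * g = g * h * c) (m : ℕ) :
    (g * h) ^ m = g ^ m * h ^ m * c ^ (m.choose 2) := by
  have key : ∀ m : ℕ, h ^ m * g = g * h ^ m * c ^ m := by
    intro m
    induction m with
    | zero => simp
    | succ m ih =>
      calc h ^ (m + 1) * g = h ^ m * (h * g) := by rw [pow_succ, mul_assoc]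
        _ = h ^ m * g * h * c := by rw [hgh]; simp only [mul_assoc]
        _ = g * h ^ m * (c ^ m * h) * c := by rw [ih]; simp only [mul_assoc]
        _ = g * h ^ (m + 1) * c ^ (m + 1) := by
          rw [((hc h).pow_left m).eq, pow_succ h, pow_succ c]; simp only [mul_assoc]
  induction m with
  | zero => simp
  | succ m ih =>
    calc (g * h) ^ (m + 1) = g ^ m * h ^ m * (c ^ (m.choose 2) * (g * h)) := by
          rw [pow_succ, ih]; simp only [mul_assoc]
      _ = g ^ m * (h ^ m * g) * h * c ^ (m.choose 2) := by
          rw [((hc (g * h)).pow_left _).eq]; simp only [mul_assoc]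
      _ = g ^ m * g * h ^ m * (c ^ m * h) * c ^ (m.choose 2) := by
          rw [key]; simp only [mul_assoc]
      _ = g ^ (m + 1) * h ^ (m + 1) * c ^ ((m + 1).choose 2) := by
          rw [((hc h).pow_left m).eq, Nat.choose_succ_succ' m 1, Nat.choose_one_right, pow_add c,
            pow_succ g, pow_succ h]
          simp only [mul_assoc]

/-- If two generators commute modulo a normal subgroup, so do all elements. -/
theorem mul_inv_mul_mem_of_closure_pair {G : Type*} [Group G] {x y : G}
    (hxy : Subgroup.closure {x, y} = ⊤) (N : Subgroup G) [N.Normal]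
    (h : (y * x)⁻¹ * (x * y) ∈ N) (g k : G) : (g * k)⁻¹ * (k * g) ∈ N := by
  have hq : (y : G ⧸ N) * x = x * y := by
    rw [← QuotientGroup.mk_mul, ← QuotientGroup.mk_mul]
    exact QuotientGroup.eq.mpr h
  have hgen : ∀ a : G ⧸ N, Commute a x → Commute a y → ∀ g : G, Commute a (g : G ⧸ N) := by
    intro a hx hy g
    have hle : (⊤ : Subgroup G) ≤
        (Subgroup.centralizer {a}).comap (QuotientGroup.mk' N) := by
      rw [← hxy, Subgroup.closure_le]
      rintro b (rfl | rfl)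
      · simpa [Subgroup.mem_centralizer_singleton_iff] using hx.symm.eq
      · simpa [Subgroup.mem_centralizer_singleton_iff] using hy.symm.eq
    have := hle (Subgroup.mem_top g)
    rw [Subgroup.mem_comap, Subgroup.mem_centralizer_singleton_iff] at this
    exact Commute.symm this
  have hx := hgen x (Commute.refl _) hq.symm
  have hy := hgen y hq (Commute.refl _)
  have := hgen g (hx g).symm (hy g).symm k
  apply QuotientGroup.eq.mp
  simpa using this.eq

theorem mul_pow_prime_of_modular {p m : ℕ} (hp : p.Prime) (hodd : Odd p)
    {G : Type*} [Group G] {x y : G} (hx : orderOf x = p ^ (m + 2))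
    (hrel : y⁻¹ * x * y = x ^ (p ^ (m + 1) + 1)) (hxy : Subgroup.closure {x, y} = ⊤)
    (g h : G) : (g * h) ^ p = g ^ p * h ^ p := by
  set z := x ^ p ^ (m + 1) with hz
  have hzp : z ^ p = 1 := by
    rw [hz, ← pow_mul, ← pow_succ, ← hx, pow_orderOf_eq_one]
  have hzx : Commute z x := (Commute.refl x).pow_left _
  have hzy : Commute z y := by
    have : y⁻¹ * z * y = z := by
      have h1 : y⁻¹ * z * y = (y⁻¹ * x * y) ^ p ^ (m + 1) := by
        simpa using (conj_pow (i := p ^ (m + 1)) (a := y⁻¹) (b := x)).symm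
      rw [h1, hrel, ← pow_mul, mul_comm, pow_mul, ← hz, pow_succ z, pow_succ p, mul_comm (p ^ m),
        pow_mul, hzp, one_pow, one_mul]
    change z * y = y * z
    rw [mul_assoc, inv_mul_eq_iff_eq_mul] at this
    exact this
  have hcen : ∀ a : G, Commute z a := by
    intro a
    have hle : (⊤ : Subgroup G) ≤ Subgroup.centralizer {z} := by
      rw [← hxy, Subgroup.closure_le]
      rintro b (rfl | rfl)
      · exact Subgroup.mem_centralizer_singleton_iff.mpr hzx.symm.eq
      · exact Subgroup.mem_centralizer_singleton_iff.mpr hzy.symm.eq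
    exact Commute.symm (Subgroup.mem_centralizer_singleton_iff.mp (hle (Subgroup.mem_top a)))
  have : (Subgroup.zpowers z).Normal := by
    refine ⟨?_⟩
    rintro _ ⟨i, rfl⟩ a
    refine ⟨i, ?_⟩
    have := ((hcen a).zpow_left i).eq
    simp only [← this, mul_inv_cancel_right]
  have hmem : (y * x)⁻¹ * (x * y) ∈ Subgroup.zpowers z := by
    have : (y * x)⁻¹ * (x * y) = z := by
      have : (y * x)⁻¹ * (x * y) = x⁻¹ * (y⁻¹ * x * y) := by group
      rw [this, hrel, pow_succ', inv_mul_cancel_left]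
    rw [this]
    exact Subgroup.mem_zpowers z
  obtain ⟨i, hi⟩ := mul_inv_mul_mem_of_closure_pair hxy (Subgroup.zpowers z) hmem g h
  have hi' : z ^ i = (g * h)⁻¹ * (h * g) := hi
  rw [mul_pow_of_commutator_central (c := z ^ i) (fun a => (hcen a).zpow_left i)
    (by rw [hi']; group)]
  obtain ⟨t, ht⟩ : p ∣ p.choose 2 := hp.dvd_choose_self two_ne_zero <| by
    exact lt_of_le_of_ne hp.two_le (by rintro rfl; exact absurd hodd (by decide))
  have : (z ^ i) ^ p.choose 2 = 1 := by
    rw [ht, pow_mul, ← zpow_natCast (z ^ i) p, ← zpow_mul, mul_comm, zpow_mul, zpow_natCast, hzp,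
      one_zpow, one_pow]
  rw [this, mul_one]

/-- In a modular `p`-group the elements killed by `p ^ k` form a subgroup of order `p ^ (k + 1)`. -/
theorem exists_omega_of_modular {p m : ℕ} (hp : p.Prime) (hodd : Odd p)
    {G : Type*} [Group G] (hcard : Nat.card G = p ^ (m + 3))
    {x y : G} (hx : orderOf x = p ^ (m + 2)) (hy : orderOf y = p)
    (hrel : y⁻¹ * x * y = x ^ (p ^ (m + 1) + 1)) (hxy : Subgroup.closure {x, y} = ⊤) (k : ℕ) :
    ∃ K : Subgroup G, (∀ g, g ∈ K ↔ g ^ p ^ k = 1) ∧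
      (1 ≤ k → k ≤ m + 2 → Nat.card K = p ^ (k + 1)) := by
  have hmul : ∀ g h : G, (g * h) ^ p ^ k = g ^ p ^ k * h ^ p ^ k := by
    intro g h
    induction k with
    | zero => simp
    | succ k ih =>
      simp only [pow_succ, pow_mul]
      rw [ih, mul_pow_prime_of_modular hp hodd hx hrel hxy]
  let f : G →* G := MonoidHom.mk' (fun g => g ^ p ^ k) hmul
  refine ⟨f.ker, fun g => MonoidHom.mem_ker, fun hk hkm => ?_⟩
  have hrange : f.range = Subgroup.zpowers (x ^ p ^ k) := by
    have hfy : f y = 1 := by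
      obtain ⟨j, rfl⟩ : ∃ j, k = j + 1 := ⟨k - 1, by omega⟩
      change y ^ p ^ (j + 1) = 1
      rw [pow_succ', pow_mul, ← hy, pow_orderOf_eq_one, one_pow]
    rw [MonoidHom.range_eq_map, ← hxy, MonoidHom.map_closure, Set.image_pair, hfy, Set.pair_comm,
      Subgroup.closure_insert_one, ← Subgroup.zpowers_eq_closure]
    rfl
  have h1 := f.ker.card_mul_index
  rw [Subgroup.index_ker, hrange, Nat.card_zpowers, orderOf_pow_of_dvd
    (pow_ne_zero _ hp.ne_zero) (by rw [hx]; exact pow_dvd_pow p hkm), hx, hcard,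
    Nat.pow_div hkm hp.pos] at h1
  apply Nat.eq_of_mul_eq_mul_right (pow_pos hp.pos (m + 2 - k))
  rw [h1, ← pow_add]
  congr 1
  omega

section Omega

variable {p N : ℕ} {G : Type*} [Group G] [Finite G] {K : ℕ → Subgroup G}

theorem card_orderOf_eq_prime_pow_succ (hp : p.Prime) (hK : ∀ k g, g ∈ K k ↔ g ^ p ^ k = 1)
    (k : ℕ) : Nat.card {g : G // orderOf g = p ^ (k + 1)} + Nat.card (K k) =
      Nat.card (K (k + 1)) := by
  classical
  have := Fintype.ofFinite G
  have e1 : Nat.card (K (k + 1)) = (Finset.univ.filter (fun g : G => g ∈ K (k + 1))).card := by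
    rw [Nat.card_eq_fintype_card, Fintype.card_subtype]
  have e2 : Nat.card (K k) = (Finset.univ.filter (fun g : G => g ∈ K k)).card := by
    rw [Nat.card_eq_fintype_card, Fintype.card_subtype]
  rw [e1, e2, Nat.card_eq_fintype_card, Fintype.card_subtype, ← Finset.card_union_of_disjoint]
  · congr 1
    ext g
    simp only [Finset.mem_union, Finset.mem_filter, Finset.mem_univ, true_and, hK,
      ← orderOf_dvd_iff_pow_eq_one]
    constructor
    · rintro (h | h)
      · rw [h]
      · exact h.trans (pow_dvd_pow p k.le_succ)
    · intro h
      obtain ⟨j, hj, hg⟩ := (Nat.dvd_prime_pow hp).mp h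
      rcases hj.lt_or_eq with hj | rfl
      · right
        rw [hg]
        exact pow_dvd_pow p (by omega)
      · exact Or.inl hg
  · rw [Finset.disjoint_left]
    intro g hg hg'
    simp only [Finset.mem_filter, Finset.mem_univ, true_and, hK,
      ← orderOf_dvd_iff_pow_eq_one] at hg hg'
    rw [hg, Nat.pow_dvd_pow_iff_le_right hp.one_lt] at hg'
    omega

theorem orderOf_eq_prime_pow_of_omega (hp : p.Prime) (hN : 1 ≤ N)
    (hcard : Nat.card G = p ^ (N + 1)) (hK : ∀ k g, g ∈ K k ↔ g ^ p ^ k = 1)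
    (hKc : ∀ k, 1 ≤ k → k ≤ N → Nat.card (K k) = p ^ (k + 1)) (g : G) :
    ∃ k ≤ N, orderOf g = p ^ k := by
  have htop : K N = ⊤ := Subgroup.eq_top_of_card_eq _ (by rw [hKc N hN le_rfl, hcard])
  apply (Nat.dvd_prime_pow hp).mp
  rw [orderOf_dvd_iff_pow_eq_one, ← hK, htop]
  exact Subgroup.mem_top g

theorem card_cyclic_subgroups_of_omega (hp : p.Prime) (hN : 1 ≤ N)
    (hcard : Nat.card G = p ^ (N + 1)) (hK : ∀ k g, g ∈ K k ↔ g ^ p ^ k = 1)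
    (hKc : ∀ k, 1 ≤ k → k ≤ N → Nat.card (K k) = p ^ (k + 1)) :
    Nat.card {H : Subgroup G // IsCyclic H} = N * p + 2 := by
  classical
  have := Fintype.ofFinite (Subgroup G)
  have hc : ∀ k, Nat.card {H : Subgroup G // IsCyclic H ∧ Nat.card H = p ^ (k + 1)} *
      (p ^ k * (p - 1)) + Nat.card (K k) = Nat.card (K (k + 1)) := by
    intro k
    rw [← card_orderOf_eq_prime_pow_succ hp hK k, ← card_cyclic_subgroups_mul_totient,
      Nat.totient_prime_pow_succ hp]
  have hK0 : Nat.card (K 0) = 1 := by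
    rw [Subgroup.card_eq_one, eq_bot_iff]
    intro g hg
    simpa [hK] using hg
  have hp1 : 0 < p - 1 := Nat.sub_pos_of_lt hp.one_lt
  obtain ⟨q, rfl⟩ : ∃ q, p = q + 1 := ⟨p - 1, by omega⟩
  simp only [Nat.add_sub_cancel] at hc hp1
  have c0 : Nat.card {H : Subgroup G // IsCyclic H ∧ Nat.card H = (q + 1) ^ 0} = 1 := by
    have := card_cyclic_subgroups_mul_totient (G := G) 1
    simpa using this
  have c1 : Nat.card {H : Subgroup G // IsCyclic H ∧ Nat.card H = (q + 1) ^ 1} = q + 2 := by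
    have := hc 0
    rw [hK0, hKc 1 le_rfl hN] at this
    apply Nat.eq_of_mul_eq_mul_right hp1
    simp only [zero_add, pow_zero, one_mul] at this
    apply Nat.add_right_cancel (m := 1)
    rw [this]
    ring
  have ck : ∀ k, k + 2 ≤ N →
      Nat.card {H : Subgroup G // IsCyclic H ∧ Nat.card H = (q + 1) ^ (k + 2)} = q + 1 := by
    intro k hk
    have := hc (k + 1)
    rw [hKc _ (by omega) (by omega), hKc _ (by omega) (by omega)] at this
    apply Nat.eq_of_mul_eq_mul_right (mul_pos (pow_pos hp.pos (k + 1)) hp1)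
    apply Nat.add_right_cancel (this.trans _)
    ring
  have hsum : Nat.card {H : Subgroup G // IsCyclic H} = ∑ k ∈ Finset.range (N + 1),
      Nat.card {H : Subgroup G // IsCyclic H ∧ Nat.card H = (q + 1) ^ k} := by
    simp only [Nat.card_eq_fintype_card (α := {H : Subgroup G // _}), Fintype.card_subtype]
    rw [← Finset.card_biUnion]
    · congr 1
      ext H
      simp only [Finset.mem_filter, Finset.mem_univ, true_and, Finset.mem_biUnion,
        Finset.mem_range]
      constructor
      · intro hH
        obtain ⟨g, rfl⟩ := Subgroup.isCyclic_iff_exists_zpowers_eq_top H |>.mp hH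
        obtain ⟨k, hk, hg⟩ := orderOf_eq_prime_pow_of_omega hp hN hcard hK hKc g
        exact ⟨k, by omega, hH, by rw [Nat.card_zpowers, hg]⟩
      · rintro ⟨k, -, hH, -⟩
        exact hH
    · intro i _ j _ hij
      rw [Function.onFun, Finset.disjoint_left]
      intro H hi hj
      simp only [Finset.mem_filter, Finset.mem_univ, true_and] at hi hj
      exact hij (Nat.pow_right_injective hp.two_le (hi.2.symm.trans hj.2))
  obtain ⟨M, rfl⟩ : ∃ M, N = M + 1 := ⟨N - 1, by omega⟩
  rw [hsum, Finset.sum_range_succ', Finset.sum_range_succ', c0, zero_add, c1,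
    Finset.sum_congr rfl (fun k hk => ck k (by have := Finset.mem_range.mp hk; omega))]
  simp only [Finset.sum_const, Finset.card_range, smul_eq_mul]
  ring

theorem card_not_cyclic_subgroups_of_omega (hp : p.Prime) (hN : 1 ≤ N)
    (hcard : Nat.card G = p ^ (N + 1)) (hK : ∀ k g, g ∈ K k ↔ g ^ p ^ k = 1)
    (hKc : ∀ k, 1 ≤ k → k ≤ N → Nat.card (K k) = p ^ (k + 1)) :
    Nat.card {H : Subgroup G // ¬ IsCyclic H} = N := by
  have hnc : ∀ k, 1 ≤ k → k ≤ N → ¬ IsCyclic (K k) := by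
    intro k hk hkN hcyc
    obtain ⟨g, hg⟩ := Subgroup.isCyclic_iff_exists_zpowers_eq_top (K k) |>.mp hcyc
    have hgk : g ∈ K k := hg ▸ Subgroup.mem_zpowers g
    have hc := hKc k hk hkN
    rw [hK, ← orderOf_dvd_iff_pow_eq_one, ← Nat.card_zpowers, hg, hc,
      Nat.pow_dvd_pow_iff_le_right hp.one_lt] at hgk
    omega
  rw [← Nat.card_fin N]
  symm
  refine Nat.card_eq_of_bijective
    (fun i : Fin N => ⟨K (i + 1), hnc _ (by omega) (by omega)⟩) ⟨?_, ?_⟩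
  · intro i j hij
    have h : K (i + 1) = K (j + 1) := congrArg Subtype.val hij
    have h2 := hKc (i + 1) (by omega) (by omega)
    rw [h, hKc (j + 1) (by omega) (by omega)] at h2
    have := Nat.pow_right_injective hp.two_le h2
    ext
    omega
  · rintro ⟨H, hH⟩
    choose e heN he using orderOf_eq_prime_pow_of_omega hp hN hcard hK hKc
    obtain ⟨g, hg⟩ := Finite.exists_max (fun g : H => e g)
    have hle : H ≤ K (e g) := by
      intro h hh
      rw [hK, ← orderOf_dvd_iff_pow_eq_one, he]
      exact pow_dvd_pow p (hg ⟨h, hh⟩)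
    have hzle : Subgroup.zpowers (g : G) ≤ H := Subgroup.zpowers_le.mpr g.2
    have he1 : 1 ≤ e g := by
      by_contra h0
      have h0 : e g = 0 := by omega
      apply hH
      have : H = ⊥ := by
        rw [eq_bot_iff]
        intro h hh
        simpa [hK, h0] using hle hh
      subst this
      infer_instance
    have hKe := hKc (e g) he1 (heN g)
    have hlt : p ^ e g < Nat.card H := by
      rw [← he, ← Nat.card_zpowers]
      refine lt_of_le_of_ne (Subgroup.card_le_of_le hzle) fun h => hH ?_
      rw [← Subgroup.eq_of_le_of_card_ge hzle h.ge]
      infer_instance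
    have hHK : H = K (e g) := by
      refine Subgroup.eq_of_le_of_card_ge hle ?_
      have hdvd := Subgroup.card_dvd_of_le hle
      rw [hKe] at hdvd ⊢
      obtain ⟨j, hj, hc⟩ := (Nat.dvd_prime_pow hp).mp hdvd
      rw [hc] at hlt ⊢
      have := (Nat.pow_lt_pow_iff_right hp.one_lt).mp hlt
      exact Nat.pow_le_pow_right hp.pos this
    have hN' := heN g
    refine ⟨⟨e g - 1, by omega⟩, Subtype.ext ?_⟩
    simp only [Nat.sub_add_cancel he1]
    exact hHK.symm

end Omega

/-- For an odd prime `p` and `n ≥ 3`, the cyclicity degree of the modular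
`p`-group `M_{p^n} = ⟨x, y | x^(p^(n−1)) = y^p = 1, y⁻¹xy = x^(p^(n−2)+1)⟩`
equals `((n−1)p + 2)/((n−1)p + n + 1)`. -/
theorem cdeg_modular_group {p : ℕ} (hp : p.Prime) (hodd : Odd p)
    {n : ℕ} (hn : 3 ≤ n)
    (G : Type*) [Group G] [Fintype G]
    (hcard : Nat.card G = p ^ n)
    (hpres : ∃ x y : G, orderOf x = p ^ (n - 1) ∧ orderOf y = p ∧
      y⁻¹ * x * y = x ^ (p ^ (n - 2) + 1) ∧ Subgroup.closure {x, y} = ⊤) :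
    cdeg G = ((n - 1 : ℚ) * p + 2) / ((n - 1 : ℚ) * p + n + 1) := by
  obtain ⟨x, y, hx, hy, hrel, hxy⟩ := hpres
  obtain ⟨m, rfl⟩ : ∃ m, n = m + 3 := ⟨n - 3, by omega⟩
  choose K hK hKc using exists_omega_of_modular hp hodd hcard hx hy hrel hxy
  have h1 := card_cyclic_subgroups_of_omega hp (by omega) hcard hK hKc
  have h2 := card_not_cyclic_subgroups_of_omega hp (by omega) hcard hK hKc
  have h3 : Nat.card (Subgroup G) = (m + 2) * p + 2 + (m + 2) := by
    classical
    rw [← h1, ← h2, ← Nat.card_sum]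
    exact Nat.card_congr (Equiv.sumCompl _).symm
  rw [cdeg, h1, h3]
  push_cast
  congr 1 <;> ring
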